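/- Fix finite nonempty types α and β, positive semidefinite matrices P₀, P₁ : Matrix (α × β) (α × β) ℂ, and a positive semidefinite ρ : Matrix β β ℂ with trace 1 such that P₀ + P₁ = I_α ⊗ ρ. Suppose Y : Matrix β β ℂ is Hermitian with I_α ⊗ Y ≥ P₁ in the Loewner order, and let p := re (Tr Y). Then for every n ≥ 1, every 0 ≤ k ≤ n, and every n-repetition strategy X: re (∑_{s ∈ Σ^n_{≥k}} Tr ((⨂ⱼ P_{s j}) * X)) ≤ p^k * (n.choose k). That is, the probability that Bob wins at least k of n independent parallel repetitions is at most p^k · C(n,k), where p bounds his optimal single-repetition winning probability. -/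

import Mathlib

open Matrix Finset ComplexOrder

/-- The `n`-fold Kronecker product of matrices `M 0, …, M (n-1)`, indexed by `Fin n → I`. -/
noncomputable def nKron {n : ℕ} {I : Type*} [Fintype I] (M : Fin n → Matrix I I ℂ) :
    Matrix (Fin n → I) (Fin n → I) ℂ :=
  fun f g => ∏ j, M j (f j) (g j)

/-- The set `Σ^n_{≥k}` of binary strings of length `n` with at least `k` ones. -/
def SigmaGe (n k : ℕ) : Finset (Fin n → Fin 2) :=
  Finset.univ.filter fun s => k ≤ (Finset.univ.filter fun j => s j = 1).card

/-- An `n`-repetition strategy for Bob. -/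
def IsParStrategy {α β : Type*} [Fintype α] [Fintype β] [DecidableEq β] (n : ℕ)
    (X : Matrix (Fin n → α × β) (Fin n → α × β) ℂ) : Prop :=
  X.PosSemidef ∧
    ∀ b b' : Fin n → β,
      ∑ a : Fin n → α, X (fun j => (a j, b j)) (fun j => (a j, b' j)) =
        if b = b' then 1 else 0

open scoped MatrixOrder in
theorem Matrix.PosSemidef.exists_eq_conjTranspose_mul_self {I : Type*} [Fintype I] [DecidableEq I]
    {A : Matrix I I ℂ} (hA : A.PosSemidef) : ∃ C : Matrix I I ℂ, A = Cᴴ * C :=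
  CStarAlgebra.nonneg_iff_eq_star_mul_self.mp hA.nonneg

theorem Matrix.PosSemidef.trace_mul_re_nonneg {I : Type*} [Fintype I] [DecidableEq I]
    {A B : Matrix I I ℂ} (hA : A.PosSemidef) (hB : B.PosSemidef) : 0 ≤ (A * B).trace.re := by
  obtain ⟨C, rfl⟩ := hA.exists_eq_conjTranspose_mul_self
  rw [Matrix.mul_assoc, Matrix.trace_mul_comm]
  exact (Complex.le_def.mp (hB.mul_mul_conjTranspose_same C).trace_nonneg).1

section nKron

variable {n : ℕ} {I : Type*} [Fintype I]

theorem nKron_conjTranspose (M : Fin n → Matrix I I ℂ) :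
    (nKron M)ᴴ = nKron fun j => (M j)ᴴ := by
  ext f g
  simp [nKron, Matrix.conjTranspose_apply]

theorem nKron_mul [DecidableEq I] (M N : Fin n → Matrix I I ℂ) :
    nKron M * nKron N = nKron fun j => M j * N j := by
  ext f g
  simp only [nKron, Matrix.mul_apply, ← Finset.prod_mul_distrib]
  rw [Finset.prod_univ_sum, Fintype.piFinset_univ]

theorem nKron_posSemidef [DecidableEq I] {M : Fin n → Matrix I I ℂ}
    (hM : ∀ j, (M j).PosSemidef) : (nKron M).PosSemidef := by
  choose C hC using fun j => (hM j).exists_eq_conjTranspose_mul_self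
  have h : nKron M = (nKron C)ᴴ * nKron C := by
    rw [nKron_conjTranspose, nKron_mul]
    exact congrArg nKron (funext hC)
  rw [h]
  exact Matrix.posSemidef_conjTranspose_mul_self _

theorem nKron_sum {κ : Type*} [DecidableEq κ] (S : Fin n → Finset κ)
    (M : Fin n → κ → Matrix I I ℂ) :
    (nKron fun j => ∑ i ∈ S j, M j i) =
      ∑ s ∈ Fintype.piFinset S, nKron fun j => M j (s j) := by
  ext f g
  simp only [nKron, Matrix.sum_apply]
  exact Finset.prod_univ_sum S _

theorem trace_nKron_sum_mul_re {κ : Type*} [DecidableEq κ] (S : Fin n → Finset κ)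
    (M : Fin n → κ → Matrix I I ℂ) (X : Matrix (Fin n → I) (Fin n → I) ℂ) :
    ((nKron fun j => ∑ i ∈ S j, M j i) * X).trace.re =
      ∑ s ∈ Fintype.piFinset S, ((nKron fun j => M j (s j)) * X).trace.re := by
  rw [nKron_sum, Matrix.sum_mul, Matrix.trace_sum, Complex.re_sum]

theorem trace_nKron_mul_re_mono [DecidableEq I] {A B : Fin n → Matrix I I ℂ}
    {X : Matrix (Fin n → I) (Fin n → I) ℂ} (hA : ∀ j, (A j).PosSemidef)
    (hAB : ∀ j, (B j - A j).PosSemidef) (hX : X.PosSemidef) :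
    (nKron A * X).trace.re ≤ (nKron B * X).trace.re := by
  let M : Fin n → Bool → Matrix I I ℂ := fun j i => bif i then A j else B j - A j
  have hB : B = fun j => ∑ i ∈ (Finset.univ : Finset Bool), M j i := by
    ext j : 1
    simp [M]
  rw [hB, trace_nKron_sum_mul_re]
  refine Finset.single_le_sum
    (f := fun s : Fin n → Bool => ((nKron fun j => M j (s j)) * X).trace.re)
    (fun s _ => (nKron_posSemidef fun j => ?_).trace_mul_re_nonneg hX)
    (a := fun _ => true) (by simp)
  cases h : s j
  exacts [hAB j, hA j]

end nKron

theorem IsParStrategy.trace_nKron_mul {α β : Type*} [Fintype α] [Fintype β] [DecidableEq α]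
    [DecidableEq β] {n : ℕ} {X : Matrix (Fin n → α × β) (Fin n → α × β) ℂ}
    (hX : IsParStrategy n X) (Z : Fin n → Matrix β β ℂ) :
    ((nKron fun j => Matrix.of fun p q : α × β =>
        (if p.1 = q.1 then (1 : ℂ) else 0) * Z j p.2 q.2) * X).trace = ∏ j, (Z j).trace := by
  have key : ∀ (a a' : Fin n → α) (b b' : Fin n → β),
      (∏ j, if a j = a' j then Z j (b j) (b' j) else 0) =
        if a = a' then ∏ j, Z j (b j) (b' j) else 0 := by
    intro a a' b b'
    rw [Finset.prod_ite_zero]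
    simp [funext_iff]
  simp only [Matrix.trace, Matrix.diag_apply, Matrix.mul_apply, nKron, Matrix.of_apply]
  let e := Equiv.arrowProdEquivProdArrow (Fin n) (fun _ => α) (fun _ => β)
  rw [← e.symm.sum_comp]
  simp_rw [← fun f => e.symm.sum_comp (f : (Fin n → α × β) → ℂ)]
  simp only [e, Equiv.arrowProdEquivProdArrow, Equiv.coe_fn_symm_mk, Fintype.sum_prod_type,
    ite_mul, one_mul, zero_mul, key]
  rw [Finset.sum_comm]
  calc _ = ∑ b : Fin n → β, ∑ b' : Fin n → β, (∏ j, Z j (b j) (b' j)) *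
        ∑ a : Fin n → α, X (fun j => (a j, b' j)) (fun j => (a j, b j)) := by
        refine Finset.sum_congr rfl fun b _ => ?_
        simp_rw [Finset.mul_sum]
        rw [Finset.sum_comm (γ := Fin n → β)]
        refine Finset.sum_congr rfl fun a _ => ?_
        rw [Finset.sum_comm]
        simp
    _ = ∑ b : Fin n → β, ∏ j, Z j (b j) (b j) := by simp [hX.2]
    _ = _ := by rw [Finset.prod_univ_sum, Fintype.piFinset_univ]

theorem sum_SigmaGe_le {n k : ℕ} {w : (Fin n → Fin 2) → ℝ} (hw : ∀ s, 0 ≤ w s) :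
    ∑ s ∈ SigmaGe n k, w s ≤ ∑ T ∈ (Finset.univ : Finset (Fin n)).powersetCard k,
      ∑ s ∈ Fintype.piFinset fun j => if j ∈ T then {1} else Finset.univ, w s := by
  have h : ∀ s : Fin n → Fin 2, ∃ T : Finset (Fin n), s ∈ SigmaGe n k →
      T ⊆ Finset.univ.filter (fun j => s j = 1) ∧ T.card = k := by
    intro s
    by_cases hs : s ∈ SigmaGe n k
    · obtain ⟨T, hT⟩ := Finset.exists_subset_card_eq (Finset.mem_filter.mp hs).2
      exact ⟨T, fun _ => hT⟩
    · exact ⟨∅, fun h => absurd h hs⟩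
  choose T hT using h
  rw [← Finset.sum_fiberwise_of_maps_to (g := T)
    (t := (Finset.univ : Finset (Fin n)).powersetCard k)
    fun s hs => Finset.mem_powersetCard.mpr ⟨Finset.subset_univ _, (hT s hs).2⟩]
  refine Finset.sum_le_sum fun U _ =>
    Finset.sum_le_sum_of_subset_of_nonneg (fun s hs => ?_) fun s _ _ => hw s
  obtain ⟨hsk, rfl⟩ := Finset.mem_filter.mp hs
  refine Fintype.mem_piFinset.mpr fun j => ?_
  split_ifs with hj
  · exact Finset.mem_singleton.mpr (Finset.mem_filter.mp ((hT s hsk).1 hj)).2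
  · exact Finset.mem_univ _


theorem stmt11 {α β : Type*} [Fintype α] [Fintype β] [DecidableEq α] [DecidableEq β]
    [Nonempty α] [Nonempty β]
    (P₀ P₁ : Matrix (α × β) (α × β) ℂ) (hP₀ : P₀.PosSemidef) (hP₁ : P₁.PosSemidef)
    (ρ : Matrix β β ℂ) (hρ : ρ.PosSemidef) (hρtr : ρ.trace = 1)
    (hPsum : P₀ + P₁ =
      Matrix.of fun p q : α × β => (if p.1 = q.1 then (1 : ℂ) else 0) * ρ p.2 q.2)
    (Y : Matrix β β ℂ) (hY : Y.IsHermitian)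
    (hYP : ((Matrix.of fun p q : α × β =>
        (if p.1 = q.1 then (1 : ℂ) else 0) * Y p.2 q.2) - P₁).PosSemidef)
    (p : ℝ) (hp : p = Y.trace.re)
    (n : ℕ) (hn : 1 ≤ n) (k : ℕ) (hk : k ≤ n)
    (X : Matrix (Fin n → α × β) (Fin n → α × β) ℂ) (hX : IsParStrategy n X) :
    (∑ s ∈ SigmaGe n k,
        ((nKron (fun j => if s j = 1 then P₁ else P₀)) * X).trace).re ≤
      p ^ k * (n.choose k : ℝ) := by
  have hP : ∀ i : Fin 2, (if i = 1 then P₁ else P₀).PosSemidef := fun i => by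
    split_ifs
    exacts [hP₁, hP₀]
  have htrY : Y.trace = (p : ℂ) := by
    have h : Y.trace = star Y.trace := by rw [← Matrix.trace_conjTranspose, hY.eq]
    rw [hp, Complex.conj_eq_iff_re.mp h.symm]
  rw [Complex.re_sum]
  refine (sum_SigmaGe_le fun s =>
    (nKron_posSemidef fun j => hP (s j)).trace_mul_re_nonneg hX.1).trans ?_
  calc _ ≤ ∑ T ∈ (Finset.univ : Finset (Fin n)).powersetCard k, p ^ k := by
        refine Finset.sum_le_sum fun T hT => ?_
        rw [← trace_nKron_sum_mul_re _ (fun _ i => if i = 1 then P₁ else P₀)]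
        refine (trace_nKron_mul_re_mono (B := fun j => Matrix.of fun p q : α × β =>
          (if p.1 = q.1 then (1 : ℂ) else 0) * (if j ∈ T then Y else ρ) p.2 q.2)
          (fun j => Matrix.posSemidef_sum _ fun i _ => hP i) (fun j => ?_) hX.1).trans_eq ?_
        · by_cases hj : j ∈ T
          · simpa [hj] using hYP
          · simpa [hj, hPsum] using
              (Matrix.PosSemidef.zero : (0 : Matrix (α × β) (α × β) ℂ).PosSemidef)
        · rw [hX.trace_nKron_mul]
          simp only [apply_ite Matrix.trace, htrY, hρtr, Finset.prod_ite_mem,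
            Finset.univ_inter, Finset.prod_const, (Finset.mem_powersetCard.mp hT).2]
          rw [← Complex.ofReal_pow, Complex.ofReal_re]
    _ = p ^ k * (n.choose k : ℝ) := by simp [mul_comm]
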